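/- Let p be a prime and let G be a finite group with center Z such that G/Z is isomorphic to a semidirect product Z_{p²} ⋊ Z_{p²}, i.e. G/Z is isomorphic either to Z_{p²} × Z_{p²} or to the nonabelian group presented by ⟨x, y | x^{p²} = y^{p²} = 1, y x = x^{p+1} y⟩. Then the commuting conjugacy class graph Γ(G) is connected. -/

import Mathlib

/-- Relators of the group `L₂ = ⟨x, y | x^(p²) = y^(p²) = 1, y x = x^(p+1) y⟩`,
where `x` is the generator `0` and `y` is the generator `1`. -/
def L2Rels (p : ℕ) : Set (FreeGroup (Fin 2)) :=
  {FreeGroup.of 0 ^ p ^ 2, FreeGroup.of 1 ^ p ^ 2,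
    FreeGroup.of 1 * FreeGroup.of 0 * (FreeGroup.of 0 ^ (p + 1) * FreeGroup.of 1)⁻¹}

/-- The nonabelian group `L₂` presented by
`⟨x, y | x^(p²) = y^(p²) = 1, y x = x^(p+1) y⟩`. -/
def L2 (p : ℕ) : Type := PresentedGroup (L2Rels p)

instance (p : ℕ) : Group (L2 p) := by unfold L2; infer_instance

/-- The commuting conjugacy class graph of `G`: vertices are the conjugacy classes of
noncentral elements of `G`, and two distinct classes are adjacent iff some element of one
commutes with some element of the other. -/
def commutingConjClassGraph (G : Type*) [Group G] :
    SimpleGraph {C : Set G // ∃ x : G, x ∉ Subgroup.center G ∧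
      C = {y : G | ∃ g : G, y = g⁻¹ * x * g}} :=
  SimpleGraph.fromRel fun A B => ∃ a ∈ A.1, ∃ b ∈ B.1, a * b = b * a

section TwoGenerators

variable {Q : Type*} [Group Q] {p e : ℕ} {x y : Q}

lemma pow_mul_pow_of_rel (rel : y * x = x ^ (1 + p * e) * y) (c a : ℕ) :
    y ^ c * x ^ a = x ^ ((1 + p * e) ^ c * a) * y ^ c := by
  induction c generalizing a with
  | zero => simp
  | succ c ih =>
    have h : y * x ^ a = (x ^ (1 + p * e)) ^ a * y := SemiconjBy.pow_right rel a
    rw [pow_succ, mul_assoc, h, ← pow_mul, ← mul_assoc, ih, mul_assoc, pow_succ, mul_assoc]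

lemma exists_eq_pow_mul_pow (hp : p ≠ 0) (hx : x ^ p ^ 2 = 1) (hy : y ^ p ^ 2 = 1)
    (rel : y * x = x ^ (1 + p * e) * y) (hgen : Subgroup.closure {x, y} = ⊤) (q : Q) :
    ∃ a b : ℕ, q = x ^ a * y ^ b := by
  have hinv : ∀ z : Q, z ^ p ^ 2 = 1 → z⁻¹ = z ^ (p ^ 2 - 1) := fun z hz => by
    rw [inv_eq_iff_mul_eq_one, ← pow_succ', Nat.sub_add_cancel (Nat.pos_of_ne_zero (by positivity)),
      hz]
  have hxS : ∀ (n : ℕ) (q : Q), (∃ a b : ℕ, q = x ^ a * y ^ b) →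
      ∃ a b : ℕ, x ^ n * q = x ^ a * y ^ b := by
    rintro n _ ⟨a, b, rfl⟩
    exact ⟨n + a, b, by rw [pow_add, mul_assoc]⟩
  have hyS : ∀ (n : ℕ) (q : Q), (∃ a b : ℕ, q = x ^ a * y ^ b) →
      ∃ a b : ℕ, y ^ n * q = x ^ a * y ^ b := by
    rintro n _ ⟨a, b, rfl⟩
    exact ⟨(1 + p * e) ^ n * a, n + b, by
      rw [← mul_assoc, pow_mul_pow_of_rel rel, mul_assoc, pow_add y]⟩
  have hq : q ∈ Subgroup.closure {x, y} := hgen ▸ Subgroup.mem_top q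
  induction hq using Subgroup.closure_induction_left with
  | one => exact ⟨0, 0, by simp⟩
  | mul_left z hz q _ ih =>
    rcases hz with rfl | rfl
    · simpa using hxS 1 q ih
    · simpa using hyS 1 q ih
  | inv_mul_cancel z hz q _ ih =>
    rcases hz with rfl | rfl
    · rw [hinv _ hx]; exact hxS _ q ih
    · rw [hinv _ hy]; exact hyS _ q ih

lemma exists_one_add_mul_pow (p e c : ℕ) : ∃ t, (1 + p * e) ^ c = 1 + p * t := by
  induction c with
  | zero => exact ⟨0, by simp⟩
  | succ c ih =>
    obtain ⟨t, ht⟩ := ih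
    exact ⟨t + e + p * t * e, by rw [pow_succ, ht]; ring⟩

lemma exists_one_add_mul_pow_self (p e : ℕ) : ∃ t, (1 + p * e) ^ p = 1 + p ^ 2 * t := by
  have h : 1 ≡ (1 + p * e) ^ p [MOD p ^ 2] := by
    have h1 : ((1 + p * e : ℕ) : ℤ) ≡ 1 [ZMOD p] := by
      rw [Int.modEq_iff_dvd]; exact ⟨-e, by push_cast; ring⟩
    have h2 : ((p : ℤ) ^ (1 + 1)) ∣ ((1 + p * e : ℕ) : ℤ) ^ p ^ 1 - 1 ^ p ^ 1 :=
      dvd_sub_pow_of_dvd_sub h1.symm.dvd 1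
    rw [Nat.modEq_iff_dvd]
    push_cast at h2 ⊢
    simpa using h2
  obtain ⟨t, ht⟩ := (Nat.modEq_iff_dvd' (Nat.one_le_pow _ _ (by omega))).1 h
  exact ⟨t, by rw [← ht, Nat.add_sub_cancel' (Nat.one_le_pow _ _ (by omega))]⟩

lemma commute_pow_of_rel (hx : x ^ p ^ 2 = 1) (rel : y * x = x ^ (1 + p * e) * y) :
    Commute x (y ^ p) := by
  obtain ⟨t, ht⟩ := exists_one_add_mul_pow_self p e
  have h := pow_mul_pow_of_rel rel p 1
  rw [ht, mul_one, pow_add, pow_mul, hx, one_pow, mul_one, pow_one] at h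
  exact h.symm

lemma exists_mul_pow_eq (rel : y * x = x ^ (1 + p * e) * y) (a b n : ℕ) :
    ∃ m, (x ^ a * y ^ b) ^ n = x ^ (a * n + p * m) * y ^ (b * n) := by
  induction n with
  | zero => exact ⟨0, by simp⟩
  | succ n ih =>
    obtain ⟨m, hm⟩ := ih
    obtain ⟨t, ht⟩ := exists_one_add_mul_pow p e (b * n)
    refine ⟨m + t * a, ?_⟩
    rw [pow_succ, hm, mul_assoc, ← mul_assoc (y ^ (b * n)), pow_mul_pow_of_rel rel, ht, mul_assoc,
      ← pow_add, ← mul_assoc, ← pow_add]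
    congr 2; ring

lemma mul_pow_ne_one_of_rel (hp : p.Prime) (hx : x ^ p ^ 2 = 1) (hxp : x ^ p ≠ 1)
    (hy : y ^ p ^ 2 = 1) (rel : y * x = x ^ (1 + p * e) * y)
    (φ : Q →* Multiplicative (ZMod (p ^ 2))) (hφx : φ x = 1)
    (hφy : φ y = Multiplicative.ofAdd 1) {a b : ℕ} (hab : ¬ (p ∣ a ∧ p ∣ b)) :
    (x ^ a * y ^ b) ^ p ≠ 1 := by
  intro h
  by_cases hb : p ∣ b
  · have ha : ¬ p ∣ a := fun ha => hab ⟨ha, hb⟩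
    obtain ⟨c, rfl⟩ := hb
    have hc : Commute (x ^ a) (y ^ (p * c)) := by
      rw [pow_mul]; exact (commute_pow_of_rel hx rel).pow_pow a c
    rw [hc.mul_pow, ← pow_mul, ← pow_mul, mul_right_comm p c p, ← sq p, pow_mul y, hy, one_pow,
      mul_one] at h
    have := Fact.mk hp
    have ho : orderOf x = p ^ (1 + 1) := orderOf_eq_prime_pow (by simpa using hxp) hx
    have hd := orderOf_dvd_of_pow_eq_one h
    rw [ho, pow_succ, pow_one] at hd
    exact ha (Nat.dvd_of_mul_dvd_mul_right hp.pos hd)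
  · have h2 := congrArg φ h
    simp only [map_pow, map_mul, hφx, hφy, one_pow, one_mul, map_one, ← ofAdd_nsmul] at h2
    rw [ofAdd_eq_one] at h2
    simp only [nsmul_eq_mul, mul_one] at h2
    rw [← Nat.cast_mul, ZMod.natCast_eq_zero_iff, sq] at h2
    exact hb (Nat.dvd_of_mul_dvd_mul_left hp.pos h2)

end TwoGenerators

lemma commute_pow_pow_of_mk_commute {G : Type*} [Group G] {X Y : G} {n : ℕ}
    (h : Commute (X : G ⧸ Subgroup.center G) ((Y : G ⧸ Subgroup.center G) ^ n))
    (hY : (Y : G ⧸ Subgroup.center G) ^ n ^ 2 = 1) : Commute (X ^ n) (Y ^ n) := by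
  rw [← QuotientGroup.mk_pow, QuotientGroup.eq_one_iff] at hY
  have hz : (Y ^ n * X)⁻¹ * (X * Y ^ n) ∈ Subgroup.center G :=
    QuotientGroup.eq.1 (by simpa using h.eq.symm)
  obtain ⟨z, hz', hzc⟩ : ∃ z, X * Y ^ n = Y ^ n * X * z ∧ z ∈ Subgroup.center G :=
    ⟨_, by group, hz⟩
  have hc : ∀ g, Commute z g := fun g => (Subgroup.mem_center_iff.1 hzc g).symm
  have h1 : SemiconjBy X (Y ^ n) (Y ^ n * z) := by
    rw [SemiconjBy, hz', mul_assoc, mul_assoc, (hc X).eq]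
  have h2 := h1.pow_right n
  rw [((hc _).symm).mul_pow, ← pow_mul, ← sq] at h2
  have hzn : z ^ n = 1 := by
    have h3 := h2.eq
    rw [Subgroup.mem_center_iff.1 hY X, mul_assoc, ((hc X).pow_left n).eq] at h3
    simpa using h3
  have h4 : SemiconjBy (Y ^ n) X (X * z⁻¹) := by
    rw [SemiconjBy, mul_assoc, (hc _).inv_left.eq, ← mul_assoc, hz', mul_inv_cancel_right]
  have h5 := h4.pow_right n
  rw [((hc X).symm.inv_right).mul_pow, inv_pow, hzn, inv_one, mul_one] at h5
  exact Commute.symm h5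

lemma connected_of_two_generators {G : Type*} [Group G] {p e : ℕ} (hp : p.Prime)
    {x y : G ⧸ Subgroup.center G} (hx : x ^ p ^ 2 = 1) (hxp : x ^ p ≠ 1)
    (hy : y ^ p ^ 2 = 1) (rel : y * x = x ^ (1 + p * e) * y)
    (hgen : Subgroup.closure {x, y} = ⊤)
    (φ : G ⧸ Subgroup.center G →* Multiplicative (ZMod (p ^ 2))) (hφx : φ x = 1)
    (hφy : φ y = Multiplicative.ofAdd 1) :
    (commutingConjClassGraph G).Connected := by
  obtain ⟨X, rfl⟩ := QuotientGroup.mk_surjective x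
  obtain ⟨Y, rfl⟩ := QuotientGroup.mk_surjective y
  have hXY : Commute (X ^ p) (Y ^ p) :=
    commute_pow_pow_of_mk_commute (commute_pow_of_rel hx rel) hy
  have hXc : X ^ p ∉ Subgroup.center G := by
    rwa [← QuotientGroup.eq_one_iff, QuotientGroup.mk_pow]
  have hcomm : ∀ (g : G) (i j : ℕ), (g : G ⧸ Subgroup.center G) =
      (X : G ⧸ Subgroup.center G) ^ (p * i) * (Y : G ⧸ Subgroup.center G) ^ (p * j) →
      Commute g (X ^ p) := by
    intro g i j h
    have hz : (X ^ (p * i) * Y ^ (p * j))⁻¹ * g ∈ Subgroup.center G :=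
      QuotientGroup.eq.1 (by simpa using h.symm)
    rw [show g = (X ^ p) ^ i * (Y ^ p) ^ j * ((X ^ (p * i) * Y ^ (p * j))⁻¹ * g) by
      rw [← pow_mul, ← pow_mul]; group]
    exact (((Commute.refl _).pow_left i).mul_left (hXY.symm.pow_left j)).mul_left
      (Subgroup.mem_center_iff.1 hz _).symm
  have hreach : ∀ A B : {C : Set G // ∃ x : G, x ∉ Subgroup.center G ∧
      C = {y : G | ∃ g : G, y = g⁻¹ * x * g}}, ∀ a ∈ A.1, ∀ b ∈ B.1, Commute a b →
      (commutingConjClassGraph G).Reachable A B := by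
    intro A B a ha b hb hab
    by_cases hAB : A = B
    · rw [hAB]
    · exact SimpleGraph.Adj.reachable
        ((SimpleGraph.fromRel_adj _ _ _).2 ⟨hAB, Or.inl ⟨a, ha, b, hb, hab⟩⟩)
  have hself : ∀ g : G, g ∈ {y : G | ∃ h : G, y = h⁻¹ * g * h} := fun g => ⟨1, by simp⟩
  rw [SimpleGraph.connected_iff_exists_forall_reachable]
  refine ⟨⟨_, X ^ p, hXc, rfl⟩, ?_⟩
  rintro ⟨_, g, hg, rfl⟩
  obtain ⟨a, b, hab⟩ := exists_eq_pow_mul_pow hp.ne_zero hx hy rel hgen (g : G ⧸ Subgroup.center G)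
  by_cases hd : p ∣ a ∧ p ∣ b
  · obtain ⟨⟨i, rfl⟩, ⟨j, rfl⟩⟩ := hd
    exact hreach _ _ _ (hself _) _ (hself _) (hcomm g i j hab).symm
  · have hgp : g ^ p ∉ Subgroup.center G := by
      rw [← QuotientGroup.eq_one_iff, QuotientGroup.mk_pow, hab]
      exact mul_pow_ne_one_of_rel hp hx hxp hy rel φ hφx hφy hd
    obtain ⟨m, hm⟩ := exists_mul_pow_eq rel a b p
    have h1 : Commute (g ^ p) (X ^ p) := hcomm _ (a + m) b (by
      rw [QuotientGroup.mk_pow, hab, hm]; congr 2 <;> ring)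
    exact (hreach _ ⟨_, g ^ p, hgp, rfl⟩ _ (hself _) _ (hself _) h1.symm).trans
      (hreach _ _ _ (hself _) _ (hself _) ((Commute.refl g).pow_left p))

namespace L2

variable (p : ℕ)

/-- The generator of `L2 p` that is written `x` in the presentation. -/
def x : L2 p := PresentedGroup.of (rels := L2Rels p) 0

/-- The generator of `L2 p` that is written `y` in the presentation. -/
def y : L2 p := PresentedGroup.of (rels := L2Rels p) 1

lemma x_pow : x p ^ p ^ 2 = 1 :=
  PresentedGroup.one_of_mem (rels := L2Rels p) (x := FreeGroup.of 0 ^ p ^ 2) (by simp [L2Rels])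

lemma y_pow : y p ^ p ^ 2 = 1 :=
  PresentedGroup.one_of_mem (rels := L2Rels p) (x := FreeGroup.of 1 ^ p ^ 2) (by simp [L2Rels])

lemma y_mul_x : y p * x p = x p ^ (p + 1) * y p :=
  PresentedGroup.mk_eq_mk_of_mul_inv_mem (rels := L2Rels p)
    (x := FreeGroup.of 1 * FreeGroup.of 0) (y := FreeGroup.of 0 ^ (p + 1) * FreeGroup.of 1)
    (by simp [L2Rels])

lemma closure_x_y : Subgroup.closure {x p, y p} = ⊤ := by
  have h : Set.range (PresentedGroup.of (rels := L2Rels p)) =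
      {PresentedGroup.of 0, PresentedGroup.of 1} := by
    ext z; simp [Fin.exists_fin_two, eq_comm]
  have hc := PresentedGroup.closure_range_of (L2Rels p)
  rw [h] at hc
  exact hc

variable {p}

lemma exists_hom {H : Type*} [Group H] {a b : H} (ha : a ^ p ^ 2 = 1) (hb : b ^ p ^ 2 = 1)
    (hab : b * a = a ^ (p + 1) * b) : ∃ φ : L2 p →* H, φ (x p) = a ∧ φ (y p) = b := by
  have h : ∀ r ∈ L2Rels p, FreeGroup.lift ![a, b] r = 1 := by
    rintro r (rfl | rfl | rfl)
    · simpa using ha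
    · simpa using hb
    · simp only [map_mul, map_inv, map_pow, FreeGroup.lift_apply_of]
      exact mul_inv_eq_one.2 hab
  exact ⟨PresentedGroup.toGroup h, PresentedGroup.toGroup.of h, PresentedGroup.toGroup.of h⟩

lemma x_pow_ne_one (hp : p.Prime) : x p ^ p ≠ 1 := by
  have h0 : ((p ^ 2 : ℕ) : ZMod (p ^ 2)) = 0 := ZMod.natCast_self _
  have hu : (1 + (p : ZMod (p ^ 2))) ^ p = 1 := by
    obtain ⟨t, ht⟩ := exists_one_add_mul_pow_self p 1
    have h := congrArg (Nat.cast : ℕ → ZMod (p ^ 2)) ht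
    push_cast at h h0
    simpa [h0] using h
  let u : (ZMod (p ^ 2))ˣ := Units.ofPowEqOne _ p hu hp.ne_zero
  have hadd : ∀ (n : ℕ) (t : ZMod (p ^ 2)),
      ((Equiv.addRight (1 : ZMod (p ^ 2)) : Equiv.Perm _) ^ n) t = t + n := by
    intro n t
    simp
  obtain ⟨φ, hφx, -⟩ := exists_hom (p := p)
    (a := (Equiv.addRight (1 : ZMod (p ^ 2)) : Equiv.Perm _)) (b := MulAction.toPermHom _ _ u)
    (by ext1 t; rw [hadd, h0]; simp)
    (by
      have hu1 : u ^ p = 1 := Units.ext hu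
      have hu2 : u ^ p ^ 2 = 1 := orderOf_dvd_iff_pow_eq_one.1
        ((orderOf_dvd_of_pow_eq_one hu1).trans (dvd_pow_self p two_ne_zero))
      rw [← map_pow, hu2, map_one])
    (by
      ext1 t
      rw [Equiv.Perm.mul_apply, Equiv.Perm.mul_apply, hadd]
      change (1 + (p : ZMod (p ^ 2))) * (t + 1) = (1 + (p : ZMod (p ^ 2))) * t + _
      push_cast; ring)
  intro h
  have h1 := congrArg (fun σ : Equiv.Perm (ZMod (p ^ 2)) => σ 0) (congrArg φ h)
  simp only [map_pow, hφx, hadd, map_one, Equiv.Perm.one_apply, zero_add] at h1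
  rw [ZMod.natCast_eq_zero_iff] at h1
  exact absurd (Nat.le_of_dvd hp.pos h1) (not_le.2 (by nlinarith [hp.two_le]))

end L2

/-- Let `p` be a prime and `G` a finite group with `G/Z(G)` isomorphic to a semidirect
product `Z_(p²) ⋊ Z_(p²)` (either `Z_(p²) × Z_(p²)` or the nonabelian group
`⟨x, y | x^(p²) = y^(p²) = 1, y x = x^(p+1) y⟩`). Then the commuting conjugacy class
graph `Γ(G)` is connected. -/
theorem commutingConjClassGraph_connected {G : Type*} [Group G] [Fintype G]
    (p : ℕ) (hp : p.Prime)
    (hiso : Nonempty ((G ⧸ Subgroup.center G) ≃*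
        (Multiplicative (ZMod (p ^ 2)) × Multiplicative (ZMod (p ^ 2)))) ∨
      Nonempty ((G ⧸ Subgroup.center G) ≃* L2 p)) :
    (commutingConjClassGraph G).Connected := by
  have h0 : ((p ^ 2 : ℕ) : ZMod (p ^ 2)) = 0 := ZMod.natCast_self _
  have hone : (Multiplicative.ofAdd (1 : ZMod (p ^ 2))) ^ p ^ 2 = 1 := by
    rw [← ofAdd_nsmul, nsmul_eq_mul, h0, zero_mul, ofAdd_zero]
  have hone' : (Multiplicative.ofAdd (1 : ZMod (p ^ 2))) ^ p ≠ 1 := by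
    rw [← ofAdd_nsmul, nsmul_eq_mul, mul_one, Ne, ofAdd_eq_one, ZMod.natCast_eq_zero_iff]
    intro h
    exact absurd (Nat.le_of_dvd hp.pos h) (not_le.2 (by nlinarith [hp.two_le]))
  rcases hiso with ⟨⟨f⟩⟩ | ⟨⟨f⟩⟩
  · have hp2 : NeZero (p ^ 2) := ⟨pow_ne_zero 2 hp.ne_zero⟩
    refine connected_of_two_generators hp (e := 0) (x := f.symm (Multiplicative.ofAdd 1, 1))
      (y := f.symm (1, Multiplicative.ofAdd 1)) ?_ ?_ ?_ ?_ ?_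
      ((MonoidHom.snd _ _).comp f.toMonoidHom) (by simp) (by simp)
    · rw [← map_pow, Prod.pow_mk, hone, one_pow, ← Prod.one_eq_mk, map_one]
    · rw [← map_pow, Ne, map_eq_one_iff _ f.symm.injective, Prod.pow_mk, Prod.mk_eq_one]
      exact fun h => hone' h.1
    · rw [← map_pow, Prod.pow_mk, hone, one_pow, ← Prod.one_eq_mk, map_one]
    · rw [mul_zero, add_zero, pow_one, ← map_mul, ← map_mul, mul_comm]
    · rw [eq_top_iff]
      intro q _
      have hgen : ∀ s : Multiplicative (ZMod (p ^ 2)),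
          s = Multiplicative.ofAdd 1 ^ (Multiplicative.toAdd s).val := by
        intro s
        rw [← ofAdd_nsmul, nsmul_eq_mul, mul_one, ZMod.natCast_zmod_val, ofAdd_toAdd]
      have hq : q = f.symm (Multiplicative.ofAdd 1, 1) ^ (Multiplicative.toAdd (f q).1).val *
          f.symm (1, Multiplicative.ofAdd 1) ^ (Multiplicative.toAdd (f q).2).val := by
        rw [← map_pow, ← map_pow, ← map_mul, MulEquiv.eq_symm_apply, Prod.pow_mk, Prod.pow_mk,
          Prod.mk_mul_mk, ← hgen, ← hgen, one_pow, one_pow, mul_one, one_mul]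
      rw [hq]
      exact mul_mem (pow_mem (Subgroup.subset_closure (by simp)) _)
        (pow_mem (Subgroup.subset_closure (by simp)) _)
  · obtain ⟨φ, hφx, hφy⟩ := L2.exists_hom (p := p) (a := 1)
      (b := Multiplicative.ofAdd (1 : ZMod (p ^ 2))) (one_pow _) hone (by simp)
    refine connected_of_two_generators hp (e := 1) (x := f.symm (L2.x p)) (y := f.symm (L2.y p))
      ?_ ?_ ?_ ?_ ?_ (φ.comp f.toMonoidHom) (by simpa using hφx) (by simpa using hφy)
    · rw [← map_pow, L2.x_pow, map_one]
    · rw [← map_pow, Ne, map_eq_one_iff _ f.symm.injective]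
      exact L2.x_pow_ne_one hp
    · rw [← map_pow, L2.y_pow, map_one]
    · rw [← map_mul, L2.y_mul_x, map_mul, map_pow, mul_one, add_comm]
    · have h := congrArg (Subgroup.map f.symm.toMonoidHom) (L2.closure_x_y p)
      rw [MonoidHom.map_closure, Set.image_pair,
        Subgroup.map_top_of_surjective _ f.symm.surjective] at h
      exact h
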